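/- For every 0 < ν < 1, the second moment of the Mainardi function satisfies ∫₀^∞ u² · M_ν(u) du = 2/Γ(1 + 2ν), the integral being convergent. -/

import Mathlib

open Real MeasureTheory Set

/-- The Mainardi function `M_ν(x) = Σ_{n=0}^∞ (−x)^n/(n! · Γ(1 − ν − νn))`. -/
noncomputable def mainardi (ν x : ℝ) : ℝ :=
  ∑' n : ℕ, (-x) ^ n / ((n.factorial : ℝ) * Real.Gamma (1 - ν - ν * n))

open Filter Topology

theorem integrableOn_rpow_mul_exp_neg_mul {a b : ℝ} (ha : 0 < a) (hb : 0 < b) :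
    IntegrableOn (fun t : ℝ => t ^ (a - 1) * Real.exp (-(b * t))) (Ioi 0) := by
  refine Integrable.of_integral_ne_zero ?_
  rw [Real.integral_rpow_mul_exp_neg_mul_Ioi ha hb]
  have := Real.Gamma_pos_of_pos ha
  positivity

theorem hasDerivAt_integral_rpow_mul_cexp {a : ℝ} (ha : 0 < a) {w : ℂ} (hw : 0 < w.re) :
    HasDerivAt (fun z : ℂ => ∫ t in Ioi (0 : ℝ), ((t ^ (a - 1) : ℝ) : ℂ) * Complex.exp (-(z * t)))
      (∫ t in Ioi (0 : ℝ), ((t ^ (a - 1) : ℝ) : ℂ) * (Complex.exp (-(w * t)) * -t)) w := by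
  have hmeas (z : ℂ) : AEStronglyMeasurable
      (fun t : ℝ => ((t ^ (a - 1) : ℝ) : ℂ) * Complex.exp (-(z * t)))
      (volume.restrict (Ioi 0)) := by
    apply Measurable.aestronglyMeasurable; fun_prop
  refine (hasDerivAt_integral_of_dominated_loc_of_deriv_le
    (F := fun (z : ℂ) (t : ℝ) => ((t ^ (a - 1) : ℝ) : ℂ) * Complex.exp (-(z * t)))
    (F' := fun (z : ℂ) (t : ℝ) => ((t ^ (a - 1) : ℝ) : ℂ) * (Complex.exp (-(z * t)) * -t))
    (s := {z : ℂ | w.re / 2 < z.re})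
    (bound := fun t : ℝ => t ^ (a + 1 - 1) * Real.exp (-(w.re / 2 * t))) ?_
    (Eventually.of_forall hmeas) ?_ ?_ ?_ (integrableOn_rpow_mul_exp_neg_mul (by linarith)
      (by linarith)) ?_).2
  · exact (isOpen_lt continuous_const Complex.continuous_re).mem_nhds (by simpa using hw)
  · refine (integrableOn_rpow_mul_exp_neg_mul ha hw).mono' (hmeas w) ?_
    filter_upwards [ae_restrict_mem measurableSet_Ioi] with t ht
    rw [norm_mul, Complex.norm_exp, Complex.norm_real, Real.norm_of_nonneg
      (Real.rpow_nonneg (le_of_lt ht) _)]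
    simp
  · apply Measurable.aestronglyMeasurable; fun_prop
  · filter_upwards [ae_restrict_mem measurableSet_Ioi] with t (ht : 0 < t) z (hz : _ < z.re)
    rw [norm_mul, norm_mul, Complex.norm_exp, Complex.norm_real, Real.norm_of_nonneg
      (Real.rpow_nonneg ht.le _), norm_neg, Complex.norm_real, Real.norm_of_nonneg ht.le,
      add_sub_right_comm, Real.rpow_add ht, Real.rpow_one, mul_assoc, mul_comm t]
    gcongr
    simp only [Complex.neg_re, Complex.re_mul_ofReal]
    gcongr
  · refine Eventually.of_forall fun t z _ => ?_
    refine HasDerivAt.const_mul _ (HasDerivAt.cexp ?_)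
    simpa using ((hasDerivAt_id z).mul_const (t : ℂ)).fun_neg

theorem integral_rpow_mul_cexp_neg_mul {a : ℝ} (ha : 0 < a) {w : ℂ} (hw : 0 < w.re) :
    ∫ t in Ioi (0 : ℝ), ((t ^ (a - 1) : ℝ) : ℂ) * Complex.exp (-(w * t)) =
      w ^ (-a : ℂ) * Real.Gamma a := by
  have hopen : IsOpen {z : ℂ | 0 < z.re} := isOpen_lt continuous_const Complex.continuous_re
  refine AnalyticOnNhd.eqOn_of_preconnected_of_frequently_eq (𝕜 := ℂ) (z₀ := 1)
    (U := {z : ℂ | 0 < z.re})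
    (f := fun z => ∫ t in Ioi (0 : ℝ), ((t ^ (a - 1) : ℝ) : ℂ) * Complex.exp (-(z * t)))
    (g := fun z => z ^ (-a : ℂ) * Real.Gamma a)
    (DifferentiableOn.analyticOnNhd (fun z hz =>
      (hasDerivAt_integral_rpow_mul_cexp ha hz).differentiableAt.differentiableWithinAt) hopen)
    (DifferentiableOn.analyticOnNhd (fun z hz => ?_) hopen)
    (convex_halfSpace_re_gt 0).isPreconnected (by simp) ?_ hw
  · exact ((differentiableAt_id.cpow_const (Or.inl hz)).mul_const _).differentiableWithinAt
  · have htend : Tendsto (fun x : ℝ => (x : ℂ)) (𝓝[>] 1) (𝓝[≠] 1) := by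
      refine tendsto_nhdsWithin_iff.2 ⟨?_, ?_⟩
      · exact (Complex.continuous_ofReal.tendsto' 1 1 (by simp)).mono_left nhdsWithin_le_nhds
      · filter_upwards [self_mem_nhdsWithin] with x (hx : 1 < x)
        simpa using hx.ne'
    refine htend.frequently (Eventually.frequently ?_)
    filter_upwards [self_mem_nhdsWithin] with x (hx : 1 < x)
    have hx0 : 0 < x := by linarith
    have key := Real.integral_rpow_mul_exp_neg_mul_Ioi ha hx0
    rw [one_div, Real.inv_rpow hx0.le, ← Real.rpow_neg hx0.le] at key
    have : (x : ℂ) ^ (-a : ℂ) * Real.Gamma a = ((x ^ (-a) * Real.Gamma a : ℝ) : ℂ) := by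
      rw [Complex.ofReal_mul, Complex.ofReal_cpow hx0.le]; simp
    rw [this, ← key, ← integral_complex_ofReal]
    push_cast
    rfl

theorem integral_rpow_mul_cexp_neg_ray {a ρ ψ : ℝ} (ha : 0 < a) (hρ : 0 < ρ)
    (hψ : -(π / 2) < ψ) (hψ' : ψ < π / 2) :
    ∫ t in Ioi (0 : ℝ), ((t ^ (a - 1) : ℝ) : ℂ) *
      Complex.exp (-(ρ * t : ℝ) * Complex.exp (ψ * Complex.I)) =
    ((ρ ^ (-a) * Real.Gamma a : ℝ) : ℂ) * Complex.exp ((-(ψ * a) : ℝ) * Complex.I) := by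
  have hc : 0 < Real.cos ψ := Real.cos_pos_of_mem_Ioo ⟨hψ, hψ'⟩
  have hr : 0 < ((ρ : ℂ) * Complex.exp (ψ * Complex.I)).re := by
    rw [Complex.re_ofReal_mul, Complex.exp_ofReal_mul_I_re]; positivity
  have key := integral_rpow_mul_cexp_neg_mul ha hr
  have hpow : ((ρ : ℂ) * Complex.exp (ψ * Complex.I)) ^ (-a : ℂ) =
      ((ρ ^ (-a) : ℝ) : ℂ) * Complex.exp ((-(ψ * a) : ℝ) * Complex.I) := by
    have h1 : (ρ : ℂ) * Complex.exp (ψ * Complex.I) =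
        Complex.exp ((Real.log ρ : ℝ) + ψ * Complex.I) := by
      rw [Complex.exp_add, ← Complex.ofReal_exp, Real.exp_log hρ]
    rw [h1, Complex.cpow_def_of_ne_zero (Complex.exp_ne_zero _), Complex.log_exp,
      Real.rpow_def_of_pos hρ, Complex.ofReal_exp, ← Complex.exp_add]
    · push_cast; ring_nf
    · simp; linarith [Real.pi_pos]
    · simp; linarith [Real.pi_pos]
  rw [hpow] at key
  rw [Complex.ofReal_mul, mul_right_comm, ← key]
  refine setIntegral_congr_fun measurableSet_Ioi fun t _ => ?_
  push_cast
  ring_nf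

theorem integral_rpow_mul_cexp_ray {a φ : ℝ} (ha : 0 < a) (hφ : π / 2 < φ) (hφ' : φ < π) :
    ∫ t in Ioi (0 : ℝ), ((t ^ (a - 1) : ℝ) : ℂ) * Complex.exp (t * Complex.exp (φ * Complex.I)) =
    (Real.Gamma a : ℂ) * Complex.exp (((π - φ) * a : ℝ) * Complex.I) := by
  have key := integral_rpow_mul_cexp_neg_ray (ψ := φ - π) ha one_pos (by linarith) (by linarith)
  have h : Complex.exp (((φ - π : ℝ) : ℂ) * Complex.I) = -Complex.exp (φ * Complex.I) := by
    rw [Complex.ofReal_sub, sub_mul, Complex.exp_sub, Complex.exp_pi_mul_I, div_neg, div_one]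
  rw [h] at key
  simpa [neg_mul_neg, ← neg_mul, neg_sub] using key

theorem gamma_mul_sin_div_pi {a : ℝ} (ha : 0 < a) :
    Real.Gamma a * Real.sin (π * a) / π = (Real.Gamma (1 - a))⁻¹ := by
  have h := Real.Gamma_mul_Gamma_one_sub a
  have hG := (Real.Gamma_pos_of_pos ha).ne'
  have : Real.Gamma (1 - a) = π / (Real.sin (π * a) * Real.Gamma a) := by
    rw [eq_comm, div_mul_eq_div_div, ← h]; field_simp
  rw [this, inv_div, mul_comm]

theorem exists_mul_rpow_le_linear_add {ν d : ℝ} (y : ℝ) (hy : 0 ≤ y) (hν0 : 0 < ν) (hν1 : ν < 1)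
    (hd : 0 < d) : ∃ C, ∀ r : ℝ, 0 < r → y * r ^ ν ≤ d * r + C := by
  have h := (tendsto_rpow_neg_atTop (sub_pos.2 hν1)).const_mul y
  rw [mul_zero] at h
  obtain ⟨R, hR⟩ := eventually_atTop.1 (h.eventually (eventually_le_nhds hd))
  refine ⟨y * (max R 0) ^ ν, fun r hr => ?_⟩
  have hC : 0 ≤ y * (max R 0) ^ ν := by positivity
  rcases le_total R r with hRr | hRr
  · have h1 : r ^ ν = r ^ (-(1 - ν)) * r := by
      rw [← Real.rpow_add_one hr.ne']; ring_nf
    have := mul_le_mul_of_nonneg_right (hR r hRr) hr.le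
    rw [h1]
    linarith
  · have : y * r ^ ν ≤ y * (max R 0) ^ ν := by
      gcongr
      exact hRr.trans (le_max_left _ _)
    have : 0 ≤ d * r := by positivity
    linarith

theorem integrableOn_exp_mul_rpow_mul_exp_rpow {ν d : ℝ} (y : ℝ) (hy : 0 ≤ y) (hν0 : 0 < ν)
    (hν1 : ν < 1) (hd : 0 < d) :
    IntegrableOn (fun r : ℝ => Real.exp (-(d * r)) * r ^ (ν - 1) * Real.exp (y * r ^ ν))
      (Ioi 0) := by
  obtain ⟨C, hC⟩ := exists_mul_rpow_le_linear_add y hy hν0 hν1 (half_pos hd)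
  refine ((integrableOn_rpow_mul_exp_neg_mul hν0 (half_pos hd)).const_mul (Real.exp C)).mono'
    (by apply Measurable.aestronglyMeasurable; fun_prop) ?_
  filter_upwards [ae_restrict_mem measurableSet_Ioi] with r (hr : 0 < r)
  rw [Real.norm_of_nonneg (by positivity)]
  calc _ = r ^ (ν - 1) * Real.exp (-(d * r) + y * r ^ ν) := by rw [Real.exp_add]; ring
    _ ≤ r ^ (ν - 1) * Real.exp (C + -(d / 2 * r)) := by
      refine mul_le_mul_of_nonneg_left (Real.exp_le_exp.2 ?_) (by positivity)
      linarith [hC r hr]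
    _ = _ := by rw [Real.exp_add]; ring

/-- The integrand of the Hankel-type representation of the Mainardi function along the ray of
argument `φ`. -/
noncomputable def hankelKernel (ν φ x r : ℝ) : ℂ :=
  Complex.exp (r * Complex.exp (φ * Complex.I)) *
    (((r ^ (ν - 1) : ℝ) : ℂ) * Complex.exp ((ν * φ : ℝ) * Complex.I)) *
    Complex.exp (-(x * r ^ ν : ℝ) * Complex.exp ((ν * φ : ℝ) * Complex.I))

theorem measurable_hankelKernel (ν φ : ℝ) :
    Measurable (fun q : ℝ × ℝ => hankelKernel ν φ q.1 q.2) := by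
  unfold hankelKernel; fun_prop

theorem norm_cexp_mul_cexp (t φ : ℝ) :
    ‖Complex.exp (t * Complex.exp (φ * Complex.I))‖ = Real.exp (t * Real.cos φ) := by
  rw [Complex.norm_exp, Complex.re_ofReal_mul, Complex.exp_ofReal_mul_I_re]

theorem norm_hankelKernel (ν φ x : ℝ) {r : ℝ} (hr : 0 < r) :
    ‖hankelKernel ν φ x r‖ =
      Real.exp (r * Real.cos φ) * r ^ (ν - 1) * Real.exp (-(x * r ^ ν) * Real.cos (ν * φ)) := by
  rw [hankelKernel, norm_mul, norm_mul, norm_mul, ← Complex.ofReal_neg, norm_cexp_mul_cexp,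
    norm_cexp_mul_cexp, Complex.norm_exp_ofReal_mul_I, Complex.norm_real,
    Real.norm_of_nonneg (by positivity), mul_one]

section Representation

variable {ν φ : ℝ}

theorem integrableOn_hankelKernel (hν0 : 0 < ν) (hν1 : ν < 1) (hφ : π / 2 < φ) (hφ' : φ < π)
    (x : ℝ) : IntegrableOn (hankelKernel ν φ x) (Ioi 0) := by
  have hd : 0 < -Real.cos φ := neg_pos.2 (Real.cos_neg_of_pi_div_two_lt_of_lt hφ (by linarith))
  refine (integrableOn_exp_mul_rpow_mul_exp_rpow |x| (abs_nonneg x) hν0 hν1 hd).mono'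
    ((measurable_hankelKernel ν φ).comp measurable_prodMk_left).aestronglyMeasurable ?_
  filter_upwards [ae_restrict_mem measurableSet_Ioi] with r (hr : 0 < r)
  rw [norm_hankelKernel _ _ _ hr]
  have h1 : r * Real.cos φ = -(-Real.cos φ * r) := by ring
  rw [h1]
  refine mul_le_mul_of_nonneg_left (Real.exp_le_exp.2 ?_) (by positivity)
  rw [show -(x * r ^ ν) * Real.cos (ν * φ) = (-x * Real.cos (ν * φ)) * r ^ ν by ring]
  gcongr
  calc _ ≤ |-x * Real.cos (ν * φ)| := le_abs_self _
    _ = |x| * |Real.cos (ν * φ)| := by rw [abs_mul, abs_neg]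
    _ ≤ |x| * 1 := by gcongr; exact Real.abs_cos_le_one _
    _ = |x| := mul_one _

theorem integral_hankelKernel_coeff (hν0 : 0 < ν) (hφ : π / 2 < φ) (hφ' : φ < π)
    (x : ℝ) (n : ℕ) :
    ∫ r in Ioi (0 : ℝ), Complex.exp (r * Complex.exp (φ * Complex.I)) *
      (((r ^ (ν - 1) : ℝ) : ℂ) * Complex.exp ((ν * φ : ℝ) * Complex.I)) *
      ((-(x * r ^ ν : ℝ) * Complex.exp ((ν * φ : ℝ) * Complex.I)) ^ n / n.factorial) =
    (((-x) ^ n / n.factorial * Real.Gamma (ν * (n + 1)) : ℝ) : ℂ) *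
      Complex.exp ((π * (ν * (n + 1)) : ℝ) * Complex.I) := by
  have ha : 0 < ν * (n + 1 : ℝ) := by positivity
  have hexp : Complex.exp ((π * (ν * (n + 1)) : ℝ) * Complex.I) =
      Complex.exp (((π - φ) * (ν * (n + 1)) : ℝ) * Complex.I) *
        Complex.exp ((ν * φ : ℝ) * Complex.I) ^ (n + 1) := by
    rw [← Complex.exp_nat_mul, ← Complex.exp_add]
    push_cast; ring_nf
  rw [hexp, Complex.ofReal_mul (_ / _), ← mul_assoc, mul_assoc _ (Real.Gamma _ : ℂ),
    ← integral_rpow_mul_cexp_ray ha hφ hφ', mul_right_comm, ← integral_const_mul]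
  refine setIntegral_congr_fun measurableSet_Ioi fun r (hr : 0 < r) => ?_
  have hpow : r ^ (ν * (n + 1) - 1) = r ^ (ν - 1) * (r ^ ν) ^ n := by
    rw [← Real.rpow_natCast (r ^ ν) n, ← Real.rpow_mul hr.le, ← Real.rpow_add hr]; ring_nf
  simp only [hpow]
  push_cast
  rw [mul_pow, neg_pow, neg_pow (x : ℂ), mul_pow]
  ring

theorem hasSum_integral_hankelKernel (hν0 : 0 < ν) (hν1 : ν < 1) (hφ : π / 2 < φ) (hφ' : φ < π)
    (x : ℝ) :
    HasSum (fun n : ℕ => (((-x) ^ n / n.factorial * Real.Gamma (ν * (n + 1)) : ℝ) : ℂ) *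
      Complex.exp ((π * (ν * (n + 1)) : ℝ) * Complex.I))
      (∫ r in Ioi (0 : ℝ), hankelKernel ν φ x r) := by
  have hd : 0 < -Real.cos φ := neg_pos.2 (Real.cos_neg_of_pi_div_two_lt_of_lt hφ (by linarith))
  simp_rw [← integral_hankelKernel_coeff hν0 hφ hφ' x]
  have hsum (r : ℝ) := (NormedSpace.expSeries_div_hasSum_exp (|x| * r ^ ν)).mul_left
    (Real.exp (-(-Real.cos φ * r)) * r ^ (ν - 1))
  simp_rw [← Real.exp_eq_exp_ℝ] at hsum
  refine hasSum_integral_of_dominated_convergence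
    (fun n r => Real.exp (-(-Real.cos φ * r)) * r ^ (ν - 1) *
      ((|x| * r ^ ν) ^ n / n.factorial)) ?_ ?_ ?_ ?_ ?_
  · intro n
    apply Measurable.aestronglyMeasurable; fun_prop
  · intro n
    filter_upwards [ae_restrict_mem measurableSet_Ioi] with r (hr : 0 < r)
    rw [norm_mul, norm_mul, norm_mul, norm_cexp_mul_cexp, Complex.norm_exp_ofReal_mul_I, norm_div,
      norm_pow, norm_mul, Complex.norm_exp_ofReal_mul_I, norm_neg, Complex.norm_real,
      Complex.norm_real, Complex.norm_natCast, norm_mul, Real.norm_eq_abs x, mul_one, mul_one,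
      Real.norm_of_nonneg (by positivity : 0 ≤ r ^ ν),
      Real.norm_of_nonneg (by positivity : 0 ≤ r ^ (ν - 1))]
    apply le_of_eq
    ring_nf
  · exact Eventually.of_forall fun r => (hsum r).summable
  · simp_rw [fun r => (hsum r).tsum_eq]
    exact integrableOn_exp_mul_rpow_mul_exp_rpow |x| (abs_nonneg x) hν0 hν1 hd
  · refine Eventually.of_forall fun r => ?_
    have h := NormedSpace.expSeries_div_hasSum_exp
      (-(x * r ^ ν : ℝ) * Complex.exp ((ν * φ : ℝ) * Complex.I))
    rw [← Complex.exp_eq_exp_ℂ] at h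
    exact h.mul_left _

theorem mainardi_eq_integral (hν0 : 0 < ν) (hν1 : ν < 1) (hφ : π / 2 < φ) (hφ' : φ < π)
    (x : ℝ) : mainardi ν x = (∫ r in Ioi (0 : ℝ), hankelKernel ν φ x r).im / π := by
  rw [← ((Complex.hasSum_im (hasSum_integral_hankelKernel hν0 hν1 hφ hφ' x)).div_const π).tsum_eq,
    mainardi]
  refine tsum_congr fun n => ?_
  rw [Complex.im_ofReal_mul, Complex.exp_ofReal_mul_I_im, mul_assoc, mul_div_assoc,
    gamma_mul_sin_div_pi (by positivity), div_mul_eq_div_div, div_eq_mul_inv _ (Real.Gamma _)]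
  ring_nf

end Representation

theorem norm_exp_sub_one_sub_id_le_of_re_nonpos {z : ℂ} (hz : z.re ≤ 0) :
    ‖Complex.exp z - 1 - z‖ ≤ 3 * ‖z‖ ^ 2 := by
  rcases le_total ‖z‖ 1 with h | h
  · have := Complex.norm_exp_sub_one_sub_id_le h
    nlinarith [sq_nonneg ‖z‖]
  · have h1 : ‖Complex.exp z‖ ≤ 1 := by
      rw [Complex.norm_exp]; exact Real.exp_le_one_iff.2 hz
    calc ‖Complex.exp z - 1 - z‖ ≤ ‖Complex.exp z‖ + ‖(1 : ℂ)‖ + ‖z‖ :=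
        (norm_sub_le _ _).trans (by gcongr; exact norm_sub_le _ _)
      _ ≤ 3 * ‖z‖ ^ 2 := by rw [norm_one]; nlinarith

theorem integral_rpow_mul_cexp_neg_mul_rpow {ν q x ψ : ℝ} (hν : 0 < ν) (hq : -1 < q) (hx : 0 < x)
    (hψ : -(π / 2) < ψ) (hψ' : ψ < π / 2) :
    ∫ r in Ioi (0 : ℝ), ((r ^ q : ℝ) : ℂ) *
      Complex.exp (-(x * r ^ ν : ℝ) * Complex.exp (ψ * Complex.I)) =
    ((ν⁻¹ * (x ^ (-((q + 1) / ν)) * Real.Gamma ((q + 1) / ν)) : ℝ) : ℂ) *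
      Complex.exp ((-(ψ * ((q + 1) / ν)) : ℝ) * Complex.I) := by
  have ha : 0 < (q + 1) / ν := div_pos (by linarith) hν
  rw [Complex.ofReal_mul ν⁻¹, mul_assoc, ← integral_rpow_mul_cexp_neg_ray ha hx hψ hψ',
    ← integral_comp_rpow_Ioi (fun t : ℝ => ((t ^ ((q + 1) / ν - 1) : ℝ) : ℂ) *
      Complex.exp (-(x * t : ℝ) * Complex.exp (ψ * Complex.I))) hν.ne', ← integral_const_mul]
  refine setIntegral_congr_fun measurableSet_Ioi fun r (hr : 0 < r) => ?_
  have h : r ^ q = ν⁻¹ * ((|ν| * r ^ (ν - 1)) * (r ^ ν) ^ ((q + 1) / ν - 1)) := by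
    rw [abs_of_pos hν, ← Real.rpow_mul hr.le, mul_assoc, ← Real.rpow_add hr,
      inv_mul_cancel_left₀ hν.ne']
    congr 1
    field_simp
    ring
  simp only [h, Complex.real_smul]
  push_cast
  ring

section Decay

variable {ν φ : ℝ}

theorem integrableOn_pow_mul_rpow_mul_cexp (hν0 : 0 < ν) (hc : 0 < Real.cos (ν * φ)) {x : ℝ}
    (hx : 0 < x) (k : ℕ) :
    IntegrableOn (fun r : ℝ => (r * Complex.exp (φ * Complex.I)) ^ k *
      (((r ^ (ν - 1) : ℝ) : ℂ) * Complex.exp ((ν * φ : ℝ) * Complex.I) *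
        Complex.exp (-(x * r ^ ν : ℝ) * Complex.exp ((ν * φ : ℝ) * Complex.I)))) (Ioi 0) := by
  refine (integrableOn_rpow_mul_exp_neg_mul_rpow (s := k + (ν - 1)) (p := ν)
    (b := x * Real.cos (ν * φ)) (by have := k.cast_nonneg (α := ℝ); linarith) hν0
    (mul_pos hx hc)).mono' (by apply Measurable.aestronglyMeasurable; fun_prop) ?_
  filter_upwards [ae_restrict_mem measurableSet_Ioi] with r (hr : 0 < r)
  rw [norm_mul, norm_mul, norm_mul, norm_pow, norm_mul, Complex.norm_exp_ofReal_mul_I,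
    Complex.norm_exp_ofReal_mul_I, ← Complex.ofReal_neg, norm_cexp_mul_cexp, Complex.norm_real,
    Complex.norm_real, Real.norm_of_nonneg hr.le,
    Real.norm_of_nonneg (by positivity : 0 ≤ r ^ (ν - 1)), Real.rpow_add hr, Real.rpow_natCast]
  apply le_of_eq
  ring_nf

theorem integral_pow_mul_rpow_mul_cexp_im (hν0 : 0 < ν) (hνφ : -(π / 2) < ν * φ)
    (hνφ' : ν * φ < π / 2) {x : ℝ} (hx : 0 < x) (k : ℕ) :
    (∫ r in Ioi (0 : ℝ), (r * Complex.exp (φ * Complex.I)) ^ k *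
      (((r ^ (ν - 1) : ℝ) : ℂ) * Complex.exp ((ν * φ : ℝ) * Complex.I) *
        Complex.exp (-(x * r ^ ν : ℝ) * Complex.exp ((ν * φ : ℝ) * Complex.I)))).im = 0 := by
  have hq : -1 < (k : ℝ) + (ν - 1) := by have := k.cast_nonneg (α := ℝ); linarith
  have h := integral_rpow_mul_cexp_neg_mul_rpow hν0 hq hx hνφ hνφ'
  have h2 : ∫ r in Ioi (0 : ℝ), (r * Complex.exp (φ * Complex.I)) ^ k *
      (((r ^ (ν - 1) : ℝ) : ℂ) * Complex.exp ((ν * φ : ℝ) * Complex.I) *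
        Complex.exp (-(x * r ^ ν : ℝ) * Complex.exp ((ν * φ : ℝ) * Complex.I))) =
      (Complex.exp (φ * Complex.I) ^ k * Complex.exp ((ν * φ : ℝ) * Complex.I)) *
      ∫ r in Ioi (0 : ℝ), ((r ^ ((k : ℝ) + (ν - 1)) : ℝ) : ℂ) *
        Complex.exp (-(x * r ^ ν : ℝ) * Complex.exp ((ν * φ : ℝ) * Complex.I)) := by
    rw [← integral_const_mul]
    refine setIntegral_congr_fun measurableSet_Ioi fun r (hr : 0 < r) => ?_
    simp only [Real.rpow_add hr, Real.rpow_natCast]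
    push_cast
    ring
  rw [h2, h, mul_left_comm, Complex.im_ofReal_mul, ← Complex.exp_nat_mul, ← Complex.exp_add,
    ← Complex.exp_add]
  have h0 : (k : ℂ) * (φ * Complex.I) + (ν * φ : ℝ) * Complex.I +
      ((-(ν * φ * ((k + (ν - 1) + 1) / ν)) : ℝ) : ℂ) * Complex.I = 0 := by
    have : ν * φ * ((k + (ν - 1) + 1) / ν) = k * φ + ν * φ := by field_simp; ring
    rw [this]
    push_cast
    ring
  rw [h0]
  simp

theorem hankelKernel_eq_add (x r : ℝ) : hankelKernel ν φ x r =
    (r * Complex.exp (φ * Complex.I)) ^ 0 *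
      (((r ^ (ν - 1) : ℝ) : ℂ) * Complex.exp ((ν * φ : ℝ) * Complex.I) *
        Complex.exp (-(x * r ^ ν : ℝ) * Complex.exp ((ν * φ : ℝ) * Complex.I))) +
    (r * Complex.exp (φ * Complex.I)) ^ 1 *
      (((r ^ (ν - 1) : ℝ) : ℂ) * Complex.exp ((ν * φ : ℝ) * Complex.I) *
        Complex.exp (-(x * r ^ ν : ℝ) * Complex.exp ((ν * φ : ℝ) * Complex.I))) +
    (Complex.exp (r * Complex.exp (φ * Complex.I)) - 1 - r * Complex.exp (φ * Complex.I)) *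
      (((r ^ (ν - 1) : ℝ) : ℂ) * Complex.exp ((ν * φ : ℝ) * Complex.I) *
        Complex.exp (-(x * r ^ ν : ℝ) * Complex.exp ((ν * φ : ℝ) * Complex.I))) := by
  rw [hankelKernel]; ring

theorem norm_hankelKernel_remainder_le (hφ : π / 2 < φ) (hφ' : φ < π) (x : ℝ) {r : ℝ}
    (hr : 0 < r) :
    ‖(Complex.exp (r * Complex.exp (φ * Complex.I)) - 1 - r * Complex.exp (φ * Complex.I)) *
      (((r ^ (ν - 1) : ℝ) : ℂ) * Complex.exp ((ν * φ : ℝ) * Complex.I) *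
        Complex.exp (-(x * r ^ ν : ℝ) * Complex.exp ((ν * φ : ℝ) * Complex.I)))‖ ≤
    3 * (r ^ (ν + 1) * Real.exp (-(x * Real.cos (ν * φ)) * r ^ ν)) := by
  have hcos := Real.cos_neg_of_pi_div_two_lt_of_lt hφ (by linarith)
  have hz : (r * Complex.exp (φ * Complex.I)).re ≤ 0 := by
    rw [Complex.re_ofReal_mul, Complex.exp_ofReal_mul_I_re]; nlinarith
  have h := norm_exp_sub_one_sub_id_le_of_re_nonpos hz
  rw [norm_mul (r : ℂ), Complex.norm_exp_ofReal_mul_I, Complex.norm_real,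
    Real.norm_of_nonneg hr.le, mul_one] at h
  rw [norm_mul, norm_mul, norm_mul, Complex.norm_exp_ofReal_mul_I, ← Complex.ofReal_neg,
    norm_cexp_mul_cexp, Complex.norm_real, Real.norm_of_nonneg (by positivity), mul_one]
  refine (mul_le_mul_of_nonneg_right h (by positivity)).trans (le_of_eq ?_)
  rw [show ν + 1 = 2 + (ν - 1) by ring, Real.rpow_add hr, Real.rpow_two]
  ring_nf

theorem exists_abs_mainardi_le_rpow (hν0 : 0 < ν) (hν1 : ν < 1) (hφ : π / 2 < φ) (hφ' : φ < π)
    (hνφ : ν * φ < π / 2) :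
    ∃ C, ∀ x : ℝ, 0 < x → |mainardi ν x| ≤ C * x ^ (-((ν + 2) / ν)) := by
  have hνφ0 : -(π / 2) < ν * φ := by
    have := mul_pos hν0 (by linarith [Real.pi_pos] : 0 < φ)
    linarith [Real.pi_pos]
  have hc : 0 < Real.cos (ν * φ) := Real.cos_pos_of_mem_Ioo ⟨hνφ0, hνφ⟩
  refine ⟨3 * (Real.cos (ν * φ) ^ (-((ν + 2) / ν)) * (1 / ν) * Real.Gamma ((ν + 2) / ν)) / π,
    fun x hx => ?_⟩
  have hb : 0 < x * Real.cos (ν * φ) := mul_pos hx hc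
  have hint := ((integrableOn_rpow_mul_exp_neg_mul_rpow (s := ν + 1) (p := ν) (by linarith) hν0
    hb).const_mul 3)
  have hbound : ∀ᵐ r ∂(volume.restrict (Ioi (0 : ℝ))), _ :=
    (ae_restrict_mem measurableSet_Ioi).mono fun r hr =>
      norm_hankelKernel_remainder_le (ν := ν) hφ hφ' x hr
  have hrem := hint.mono' (by apply Measurable.aestronglyMeasurable; fun_prop) hbound
  have hle := norm_integral_le_of_norm_le hint hbound
  rw [integral_const_mul, integral_rpow_mul_exp_neg_mul_rpow hν0 (by linarith) hb] at hle
  have h0 := integrableOn_pow_mul_rpow_mul_cexp hν0 hc hx 0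
  have h1 := integrableOn_pow_mul_rpow_mul_cexp hν0 hc hx 1
  rw [mainardi_eq_integral hν0 hν1 hφ hφ' x]
  simp_rw [hankelKernel_eq_add]
  rw [integral_add (h0.fun_add h1) hrem, integral_add h0 h1, Complex.add_im, Complex.add_im,
    integral_pow_mul_rpow_mul_cexp_im hν0 hνφ0 hνφ hx,
    integral_pow_mul_rpow_mul_cexp_im hν0 hνφ0 hνφ hx, zero_add, zero_add, abs_div,
    abs_of_pos Real.pi_pos, div_mul_eq_mul_div]
  gcongr
  refine (Complex.abs_im_le_norm _).trans (hle.trans (le_of_eq ?_))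
  rw [Real.mul_rpow hx.le hc.le, show ν + 1 + 1 = ν + 2 by ring, neg_div]
  ring

theorem exists_abs_mainardi_le (hν0 : 0 < ν) (hν1 : ν < 1) (hφ : π / 2 < φ) (hφ' : φ < π)
    (hc : 0 < Real.cos (ν * φ)) : ∃ C, ∀ x : ℝ, 0 < x → |mainardi ν x| ≤ C := by
  have hd : 0 < -Real.cos φ := neg_pos.2 (Real.cos_neg_of_pi_div_two_lt_of_lt hφ (by linarith))
  have hint := integrableOn_rpow_mul_exp_neg_mul hν0 hd
  refine ⟨(∫ r in Ioi (0 : ℝ), r ^ (ν - 1) * Real.exp (-(-Real.cos φ * r))) / π, fun x hx => ?_⟩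
  rw [mainardi_eq_integral hν0 hν1 hφ hφ' x, abs_div, abs_of_pos Real.pi_pos]
  gcongr
  refine (Complex.abs_im_le_norm _).trans (norm_integral_le_of_norm_le hint ?_)
  filter_upwards [ae_restrict_mem measurableSet_Ioi] with r (hr : 0 < r)
  rw [norm_hankelKernel _ _ _ hr]
  have : Real.exp (-(x * r ^ ν) * Real.cos (ν * φ)) ≤ 1 :=
    Real.exp_le_one_iff.2 (by
      have : 0 ≤ x * r ^ ν * Real.cos (ν * φ) := by positivity
      linarith)
  refine (mul_le_of_le_one_right (by positivity) this).trans (le_of_eq ?_)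
  ring_nf

theorem measurable_mainardi (hν0 : 0 < ν) (hν1 : ν < 1) (hφ : π / 2 < φ) (hφ' : φ < π) :
    Measurable (mainardi ν) := by
  have h : mainardi ν = fun x => (∫ r in Ioi (0 : ℝ), hankelKernel ν φ x r).im / π :=
    funext (mainardi_eq_integral hν0 hν1 hφ hφ')
  rw [h]
  have := StronglyMeasurable.integral_prod_right (f := hankelKernel ν φ)
    (measurable_hankelKernel ν φ).stronglyMeasurable (ν := volume.restrict (Ioi (0 : ℝ)))
  exact (Complex.measurable_im.comp this.measurable).div_const π

end Decay

section Mellin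

variable {ν φ : ℝ}

theorem integral_rpow_mul_hankelKernel {s r : ℝ} (hs : 0 < s)
    (hνφ0 : -(π / 2) < ν * φ) (hνφ : ν * φ < π / 2) (hr : 0 < r) :
    ∫ x in Ioi (0 : ℝ), ((x ^ (s - 1) : ℝ) : ℂ) * hankelKernel ν φ x r =
      Real.Gamma s * Complex.exp ((φ * (ν * (1 - s)) : ℝ) * Complex.I) *
        (((r ^ (ν * (1 - s) - 1) : ℝ) : ℂ) * Complex.exp (r * Complex.exp (φ * Complex.I))) := by
  have hrν : 0 < r ^ ν := Real.rpow_pos_of_pos hr ν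
  have h := integral_rpow_mul_cexp_neg_ray hs hrν hνφ0 hνφ
  have hpow : r ^ (ν * (1 - s) - 1) = r ^ (ν - 1) * (r ^ ν) ^ (-s) := by
    rw [← Real.rpow_mul hr.le, ← Real.rpow_add hr]; ring_nf
  have hexp : Complex.exp ((φ * (ν * (1 - s)) : ℝ) * Complex.I) =
      Complex.exp ((ν * φ : ℝ) * Complex.I) * Complex.exp ((-(ν * φ * s) : ℝ) * Complex.I) := by
    rw [← Complex.exp_add]; push_cast; ring_nf
  calc _ = Complex.exp (r * Complex.exp (φ * Complex.I)) *
      (((r ^ (ν - 1) : ℝ) : ℂ) * Complex.exp ((ν * φ : ℝ) * Complex.I)) *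
      ∫ x in Ioi (0 : ℝ), ((x ^ (s - 1) : ℝ) : ℂ) *
        Complex.exp (-(r ^ ν * x : ℝ) * Complex.exp ((ν * φ : ℝ) * Complex.I)) := by
        rw [← integral_const_mul]
        congr 1 with x
        rw [hankelKernel, mul_comm x]
        ring
    _ = _ := by
        rw [h, hpow, hexp]
        push_cast
        ring

theorem integrable_prod_rpow_mul_hankelKernel {s : ℝ} (hs0 : 0 < s) (hs1 : s < 1) (hν0 : 0 < ν)
    (hφ : π / 2 < φ) (hφ' : φ < π) (hc : 0 < Real.cos (ν * φ)) :
    Integrable (Function.uncurry fun x r : ℝ => ((x ^ (s - 1) : ℝ) : ℂ) * hankelKernel ν φ x r)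
      ((volume.restrict (Ioi (0 : ℝ))).prod (volume.restrict (Ioi (0 : ℝ)))) := by
  have hd : 0 < -Real.cos φ := neg_pos.2 (Real.cos_neg_of_pi_div_two_lt_of_lt hφ (by linarith))
  have ha : 0 < ν * (1 - s) := mul_pos hν0 (by linarith)
  have hmeas : Measurable
      (Function.uncurry fun x r : ℝ => ((x ^ (s - 1) : ℝ) : ℂ) * hankelKernel ν φ x r) := by
    refine Measurable.mul ?_ (measurable_hankelKernel ν φ)
    fun_prop
  have hnorm {x r : ℝ} (hx : 0 < x) (hr : 0 < r) :
      ‖((x ^ (s - 1) : ℝ) : ℂ) * hankelKernel ν φ x r‖ =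
        Real.exp (r * Real.cos φ) * r ^ (ν - 1) *
          (x ^ (s - 1) * Real.exp (-(r ^ ν * Real.cos (ν * φ) * x))) := by
    rw [norm_mul, norm_hankelKernel _ _ _ hr, Complex.norm_real,
      Real.norm_of_nonneg (by positivity)]
    ring_nf
  refine (integrable_prod_iff' hmeas.aestronglyMeasurable).2 ⟨?_, ?_⟩
  · filter_upwards [ae_restrict_mem measurableSet_Ioi] with r (hr : 0 < r)
    refine ((integrableOn_rpow_mul_exp_neg_mul hs0 (by positivity :
      0 < r ^ ν * Real.cos (ν * φ))).const_mul (Real.exp (r * Real.cos φ) * r ^ (ν - 1))).mono'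
      (hmeas.comp measurable_prodMk_right).aestronglyMeasurable ?_
    filter_upwards [ae_restrict_mem measurableSet_Ioi] with x (hx : 0 < x)
    exact (hnorm hx hr).le
  · refine ((integrableOn_rpow_mul_exp_neg_mul ha hd).const_mul
      ((1 / Real.cos (ν * φ)) ^ s * Real.Gamma s)).congr ?_
    filter_upwards [ae_restrict_mem measurableSet_Ioi] with r (hr : 0 < r)
    have hrν : 0 < r ^ ν := Real.rpow_pos_of_pos hr ν
    have h1 : ∫ x in Ioi (0 : ℝ), ‖((x ^ (s - 1) : ℝ) : ℂ) * hankelKernel ν φ x r‖ =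
        Real.exp (r * Real.cos φ) * r ^ (ν - 1) *
          ((1 / (r ^ ν * Real.cos (ν * φ))) ^ s * Real.Gamma s) := by
      rw [← Real.integral_rpow_mul_exp_neg_mul_Ioi hs0 (by positivity), ← integral_const_mul]
      exact setIntegral_congr_fun measurableSet_Ioi fun x hx => hnorm hx hr
    have h2 : r ^ (ν * (1 - s) - 1) = r ^ (ν - 1) * (1 / r ^ ν) ^ s := by
      rw [one_div, ← Real.rpow_neg hr.le, ← Real.rpow_mul hr.le, ← Real.rpow_add hr]; ring_nf
    simp only [Function.uncurry_apply_pair]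
    rw [h1, h2, ← one_div_mul_one_div,
      Real.mul_rpow (by positivity) (by positivity)]
    ring_nf

theorem integral_rpow_mul_mainardi {s : ℝ} (hs0 : 0 < s) (hs1 : s < 1) (hν0 : 0 < ν)
    (hν1 : ν < 1) (hφ : π / 2 < φ) (hφ' : φ < π) (hνφ : ν * φ < π / 2) :
    ∫ x in Ioi (0 : ℝ), x ^ (s - 1) * mainardi ν x =
      Real.Gamma s * (Real.Gamma (1 - ν * (1 - s)))⁻¹ := by
  have hνφ0 : -(π / 2) < ν * φ := by
    have := mul_pos hν0 (by linarith [Real.pi_pos] : 0 < φ)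
    linarith [Real.pi_pos]
  have hc : 0 < Real.cos (ν * φ) := Real.cos_pos_of_mem_Ioo ⟨hνφ0, hνφ⟩
  have ha : 0 < ν * (1 - s) := mul_pos hν0 (by linarith)
  have hI := integrable_prod_rpow_mul_hankelKernel hs0 hs1 hν0 hφ hφ' hc
  have hval : ∫ x in Ioi (0 : ℝ), ∫ r in Ioi (0 : ℝ),
      ((x ^ (s - 1) : ℝ) : ℂ) * hankelKernel ν φ x r =
      ((Real.Gamma s * Real.Gamma (ν * (1 - s)) : ℝ) : ℂ) *
        Complex.exp ((π * (ν * (1 - s)) : ℝ) * Complex.I) := by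
    rw [integral_integral_swap hI, setIntegral_congr_fun measurableSet_Ioi
      fun r hr => integral_rpow_mul_hankelKernel hs0 hνφ0 hνφ hr, integral_const_mul,
      integral_rpow_mul_cexp_ray ha hφ hφ']
    have hexp : Complex.exp ((π * (ν * (1 - s)) : ℝ) * Complex.I) =
        Complex.exp ((φ * (ν * (1 - s)) : ℝ) * Complex.I) *
          Complex.exp (((π - φ) * (ν * (1 - s)) : ℝ) * Complex.I) := by
      rw [← Complex.exp_add]; push_cast; ring_nf
    rw [hexp]
    push_cast
    ring
  have him := Complex.imCLM.integral_comp_comm hI.integral_prod_left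
  simp only [Function.uncurry_apply_pair, Complex.imCLM_apply] at him
  rw [hval] at him
  simp only [Complex.im_ofReal_mul, Complex.exp_ofReal_mul_I_im, integral_const_mul] at him
  rw [← gamma_mul_sin_div_pi ha, ← mul_div_assoc, ← mul_assoc, ← him, ← integral_div]
  congr 1 with x
  rw [mainardi_eq_integral hν0 hν1 hφ hφ' x, mul_div_assoc]

theorem mellin_mainardi {s : ℝ} (hs0 : 0 < s) (hs1 : s < 1) (hν0 : 0 < ν)
    (hν1 : ν < 1) (hφ : π / 2 < φ) (hφ' : φ < π) (hνφ : ν * φ < π / 2) :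
    mellin (fun x => (mainardi ν x : ℂ)) s =
      Complex.Gamma s * (Complex.Gamma (1 - ν * (1 - s)))⁻¹ := by
  have h : ((Real.Gamma s * (Real.Gamma (1 - ν * (1 - s)))⁻¹ : ℝ) : ℂ) =
      Complex.Gamma s * (Complex.Gamma (1 - ν * (1 - s)))⁻¹ := by
    push_cast [← Complex.Gamma_ofReal]; rfl
  rw [← h, ← integral_rpow_mul_mainardi hs0 hs1 hν0 hν1 hφ hφ' hνφ, ← integral_complex_ofReal,
    mellin]
  refine setIntegral_congr_fun measurableSet_Ioi fun x (hx : 0 < x) => ?_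
  simp [Complex.ofReal_cpow hx.le]

theorem mellin_mainardi_of_re_lt {s : ℂ} (hs0 : 0 < s.re) (hs : s.re < (ν + 2) / ν) (hν0 : 0 < ν)
    (hν1 : ν < 1) (hφ : π / 2 < φ) (hφ' : φ < π) (hνφ : ν * φ < π / 2) :
    MellinConvergent (fun x => (mainardi ν x : ℂ)) s ∧
    mellin (fun x => (mainardi ν x : ℂ)) s =
      Complex.Gamma s * (Complex.Gamma (1 - ν * (1 - s)))⁻¹ := by
  have hνφ0 : -(π / 2) < ν * φ := by
    have := mul_pos hν0 (by linarith [Real.pi_pos] : 0 < φ)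
    linarith [Real.pi_pos]
  have hc : 0 < Real.cos (ν * φ) := Real.cos_pos_of_mem_Ioo ⟨hνφ0, hνφ⟩
  obtain ⟨B, hB⟩ := exists_abs_mainardi_le hν0 hν1 hφ hφ' hc
  obtain ⟨C, hC⟩ := exists_abs_mainardi_le_rpow hν0 hν1 hφ hφ' hνφ
  have hmeas : Measurable (fun x => (mainardi ν x : ℂ)) :=
    Complex.measurable_ofReal.comp (measurable_mainardi hν0 hν1 hφ hφ')
  have hloc : LocallyIntegrableOn (fun x => (mainardi ν x : ℂ)) (Ioi 0) := by
    intro x hx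
    refine ⟨Ioo 0 (x + 1), ?_, Measure.integrableOn_of_bounded (M := B) (by simp)
      hmeas.aestronglyMeasurable ?_⟩
    · exact mem_nhdsWithin_of_mem_nhds (Ioo_mem_nhds hx (by simp))
    · filter_upwards [ae_restrict_mem measurableSet_Ioo] with t ht
      rw [Complex.norm_real]
      exact hB t ht.1
  have htop : (fun x => (mainardi ν x : ℂ)) =O[atTop] fun x : ℝ => x ^ (-((ν + 2) / ν)) := by
    refine Asymptotics.IsBigO.of_bound C ?_
    filter_upwards [eventually_gt_atTop 0] with x hx
    rw [Complex.norm_real, Real.norm_of_nonneg (Real.rpow_nonneg hx.le _)]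
    exact hC x hx
  have hbot : (fun x => (mainardi ν x : ℂ)) =O[𝓝[>] 0] fun x : ℝ => x ^ (-(0 : ℝ)) := by
    refine Asymptotics.IsBigO.of_bound B ?_
    filter_upwards [self_mem_nhdsWithin] with x hx
    simpa using hB x hx
  refine ⟨mellinConvergent_of_isBigO_rpow hloc htop hs hbot hs0, ?_⟩
  have hopen : IsOpen {z : ℂ | 0 < z.re ∧ z.re < (ν + 2) / ν} :=
    (isOpen_lt continuous_const Complex.continuous_re).inter
      (isOpen_lt Complex.continuous_re continuous_const)
  have h1A : 1 < (ν + 2) / ν := by rw [lt_div_iff₀ hν0]; linarith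
  refine AnalyticOnNhd.eqOn_of_preconnected_of_frequently_eq (𝕜 := ℂ) (z₀ := ((1 / 2 : ℝ) : ℂ))
    (U := {z : ℂ | 0 < z.re ∧ z.re < (ν + 2) / ν})
    (f := mellin (fun x => (mainardi ν x : ℂ)))
    (g := fun z => Complex.Gamma z * (Complex.Gamma (1 - ν * (1 - z)))⁻¹)
    (DifferentiableOn.analyticOnNhd (fun z hz => (mellin_differentiableAt_of_isBigO_rpow hloc htop
      hz.2 hbot hz.1).differentiableWithinAt) hopen)
    (DifferentiableOn.analyticOnNhd (fun z hz => ?_) hopen)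
    ((convex_halfSpace_re_gt 0).inter (convex_halfSpace_re_lt _)).isPreconnected
    ⟨by norm_num [Complex.ofReal_re], by rw [Complex.ofReal_re]; linarith⟩ ?_ ⟨hs0, hs⟩
  · refine DifferentiableAt.differentiableWithinAt (DifferentiableAt.mul
      (Complex.differentiableAt_Gamma z fun m h => ?_) ?_)
    · have hz0 := hz.1
      rw [h] at hz0
      simp only [Complex.neg_re, Complex.natCast_re] at hz0
      have := m.cast_nonneg (α := ℝ)
      linarith
    · exact (Complex.differentiable_one_div_Gamma _).comp z
        (f := fun z : ℂ => 1 - ν * (1 - z)) (by fun_prop)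
  · have htend : Tendsto (fun x : ℝ => (x : ℂ)) (𝓝[>] (1 / 2)) (𝓝[≠] ((1 / 2 : ℝ) : ℂ)) := by
      refine tendsto_nhdsWithin_iff.2 ⟨?_, ?_⟩
      · exact Complex.continuous_ofReal.continuousAt.tendsto.mono_left nhdsWithin_le_nhds
      · filter_upwards [self_mem_nhdsWithin] with x (hx : 1 / 2 < x)
        exact fun h => hx.ne' (Complex.ofReal_injective h)
    refine htend.frequently (Eventually.frequently ?_)
    filter_upwards [Ioo_mem_nhdsGT (show (1 / 2 : ℝ) < 1 by norm_num)] with x hx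
    exact mellin_mainardi (by linarith [hx.1]) hx.2 hν0 hν1 hφ hφ' hνφ

end Mellin

theorem mainardi_second_moment (ν : ℝ) (hν0 : 0 < ν) (hν1 : ν < 1) :
    IntegrableOn (fun u : ℝ => u ^ 2 * mainardi ν u) (Ioi 0) ∧
    ∫ u in Ioi (0 : ℝ), u ^ 2 * mainardi ν u = 2 / Real.Gamma (1 + 2 * ν) := by
  have hpi := Real.pi_pos
  have h1 : 0 < 1 + ν := by linarith
  have hφ : π / 2 < π / (1 + ν) := div_lt_div_of_pos_left hpi h1 (by linarith)
  have hφ' : π / (1 + ν) < π := div_lt_self hpi (by linarith)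
  have hνφ : ν * (π / (1 + ν)) < π / 2 := by
    rw [← mul_div_assoc, div_lt_div_iff₀ h1 two_pos]
    nlinarith
  have h3 : (3 : ℂ).re < (ν + 2) / ν := by
    rw [lt_div_iff₀ hν0]
    norm_num
    linarith
  obtain ⟨hconv, hval⟩ := mellin_mainardi_of_re_lt (s := 3) (by norm_num) h3 hν0 hν1 hφ hφ' hνφ
  have hfun : (fun u : ℝ => (u : ℂ) ^ ((3 : ℂ) - 1) • (mainardi ν u : ℂ)) =
      fun u : ℝ => ((u ^ 2 * mainardi ν u : ℝ) : ℂ) := by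
    funext u
    rw [show (3 : ℂ) - 1 = 2 by norm_num, Complex.cpow_ofNat]
    simp
  rw [MellinConvergent, hfun] at hconv
  rw [mellin, hfun, integral_complex_ofReal] at hval
  refine ⟨hconv.re, ?_⟩
  have hG : Complex.Gamma 3 = 2 := by
    rw [show (3 : ℂ) = ((2 : ℕ) : ℂ) + 1 by norm_num, Complex.Gamma_nat_eq_factorial]
    norm_num
  have harg : (1 : ℂ) - ν * (1 - 3) = ((1 + 2 * ν : ℝ) : ℂ) := by push_cast; ring
  rw [hG, harg, Complex.Gamma_ofReal, ← div_eq_mul_inv] at hval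
  exact_mod_cast hval
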